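/- Let R₁, R₂ be coherent rings with finite Gorenstein weak dimensions. Then the class of strongly Gorenstein flat (R₁×R₂)-modules is projectively resolving if and only if the classes of strongly Gorenstein flat Rᵢ-modules are projectively resolving for i = 1 and i = 2. -/

import Mathlib

universe u

open LinearMap DirectSum

section Defs

variable (R : Type u) [CommRing R]

/-- `Ext¹_R(M, Q) = 0`, expressed by the splitting of all extensions of `M` by `Q`. -/
def Ext1Zero (M Q : Type u) [AddCommGroup M] [Module R M] [AddCommGroup Q] [Module R Q] :
    Prop :=
  ∀ (E : ModuleCat.{u} R) (i : Q →ₗ[R] E) (p : E →ₗ[R] M),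
    Function.Injective i → Function.Surjective p → LinearMap.range i = LinearMap.ker p →
      ∃ s : M →ₗ[R] E, p ∘ₗ s = LinearMap.id

/-- `Tor₁^R(M, N) = 0`, expressed via flat presentations of `N`:
for every surjection `p : F ↠ N` with `F` flat, `ker p ⊗ M → F ⊗ M` is injective. -/
def Tor1Zero (M N : Type u) [AddCommGroup M] [Module R M] [AddCommGroup N] [Module R N] :
    Prop :=
  ∀ (F : ModuleCat.{u} R), Module.Flat R F →
    ∀ p : F →ₗ[R] N, Function.Surjective p →
      Function.Injective (LinearMap.rTensor M (LinearMap.ker p).subtype)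

/-- `M` is strongly Gorenstein projective: there is an exact complex
`⋯ → P → P → P → ⋯` with a single projective `P` and single differential `f`,
which stays exact under `Hom(-, Q)` for every projective `Q`, and `M ≅ Im f`. -/
def IsSGProjective (M : Type u) [AddCommGroup M] [Module R M] : Prop :=
  ∃ P : ModuleCat.{u} R, Module.Projective R P ∧
    ∃ f : P →ₗ[R] P, f ∘ₗ f = 0 ∧ LinearMap.ker f = LinearMap.range f ∧
      Nonempty (M ≃ₗ[R] LinearMap.range f) ∧
      ∀ Q : ModuleCat.{u} R, Module.Projective R Q →
        ∀ g : P →ₗ[R] Q, g ∘ₗ f = 0 → ∃ h : P →ₗ[R] Q, g = h ∘ₗ f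

/-- `M` is strongly Gorenstein flat: there is an exact complex
`⋯ → F → F → F → ⋯` with a single flat `F` and single differential `f`,
which stays exact under `- ⊗ I` for every injective `I`, and `M ≅ Im f`. -/
def IsSGFlat (M : Type u) [AddCommGroup M] [Module R M] : Prop :=
  ∃ F : ModuleCat.{u} R, Module.Flat R F ∧
    ∃ f : F →ₗ[R] F, f ∘ₗ f = 0 ∧ LinearMap.ker f = LinearMap.range f ∧
      Nonempty (M ≃ₗ[R] LinearMap.range f) ∧
      ∀ I : ModuleCat.{u} R, Module.Injective R I →
        LinearMap.ker (LinearMap.rTensor I f) = LinearMap.range (LinearMap.rTensor I f)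

/-- `M` is Gorenstein projective: it is a syzygy of a totally acyclic complex of
projective modules. -/
def IsGProjective (M : Type u) [AddCommGroup M] [Module R M] : Prop :=
  ∃ (P : ℤ → ModuleCat.{u} R) (d : ∀ i : ℤ, P (i + 1) →ₗ[R] P i),
    (∀ i, Module.Projective R (P i)) ∧
    (∀ i, d i ∘ₗ d (i + 1) = 0) ∧
    (∀ i, LinearMap.ker (d i) = LinearMap.range (d (i + 1))) ∧
    Nonempty (M ≃ₗ[R] LinearMap.range (d 0)) ∧
    ∀ Q : ModuleCat.{u} R, Module.Projective R Q →
      ∀ (i : ℤ) (g : P (i + 1) →ₗ[R] Q), g ∘ₗ d (i + 1) = 0 →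
        ∃ h : P i →ₗ[R] Q, g = h ∘ₗ d i

/-- `M` is Gorenstein flat: it is a syzygy of an exact complex of flat modules
which stays exact under `- ⊗ I` for every injective `I`. -/
def IsGFlat (M : Type u) [AddCommGroup M] [Module R M] : Prop :=
  ∃ (F : ℤ → ModuleCat.{u} R) (d : ∀ i : ℤ, F (i + 1) →ₗ[R] F i),
    (∀ i, Module.Flat R (F i)) ∧
    (∀ i, d i ∘ₗ d (i + 1) = 0) ∧
    (∀ i, LinearMap.ker (d i) = LinearMap.range (d (i + 1))) ∧
    Nonempty (M ≃ₗ[R] LinearMap.range (d 0)) ∧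
    ∀ I : ModuleCat.{u} R, Module.Injective R I →
      ∀ i : ℤ, LinearMap.ker (LinearMap.rTensor I (d i)) =
        LinearMap.range (LinearMap.rTensor I (d (i + 1)))

/-- A class of `R`-modules is projectively resolving if it contains the projectives and,
in every short exact sequence `0 → A → B → C → 0` with `C` in the class, `A` is in the
class iff `B` is. -/
def ProjResolving (X : ModuleCat.{u} R → Prop) : Prop :=
  (∀ P : ModuleCat.{u} R, Module.Projective R P → X P) ∧
  ∀ (A B C : ModuleCat.{u} R) (i : A →ₗ[R] B) (p : B →ₗ[R] C),
    Function.Injective i → Function.Surjective p → LinearMap.range i = LinearMap.ker p →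
      X C → (X A ↔ X B)

/-- Gorenstein projective dimension at most `n`. -/
def GpdLE : ℕ → ModuleCat.{u} R → Prop
  | 0, M => IsGProjective R M
  | n + 1, M => ∃ (G : ModuleCat.{u} R) (p : G →ₗ[R] M),
      IsGProjective R G ∧ Function.Surjective p ∧ GpdLE n (ModuleCat.of R (LinearMap.ker p))

/-- Gorenstein flat dimension at most `n`. -/
def GfdLE : ℕ → ModuleCat.{u} R → Prop
  | 0, M => IsGFlat R M
  | n + 1, M => ∃ (G : ModuleCat.{u} R) (p : G →ₗ[R] M),
      IsGFlat R G ∧ Function.Surjective p ∧ GfdLE n (ModuleCat.of R (LinearMap.ker p))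

/-- Flat dimension at most `n`. -/
def FlatDimLE : ℕ → ModuleCat.{u} R → Prop
  | 0, M => Module.Flat R M
  | n + 1, M => ∃ (G : ModuleCat.{u} R) (p : G →ₗ[R] M),
      Module.Flat R G ∧ Function.Surjective p ∧ FlatDimLE n (ModuleCat.of R (LinearMap.ker p))

/-- Projective dimension at most `n`. -/
def ProjDimLE : ℕ → ModuleCat.{u} R → Prop
  | 0, M => Module.Projective R M
  | n + 1, M => ∃ (G : ModuleCat.{u} R) (p : G →ₗ[R] M),
      Module.Projective R G ∧ Function.Surjective p ∧
        ProjDimLE n (ModuleCat.of R (LinearMap.ker p))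

/-- `R` is a coherent ring: every finitely generated ideal is finitely presented. -/
def IsCoherent : Prop :=
  ∀ I : Ideal R, I.FG → Module.FinitePresentation R I

end Defs

section Helpers

open TensorProduct

lemma exact_conj {N N' : Type*} [AddCommMonoid N] [AddCommMonoid N'] (e : N ≃+ N')
    (f : N → N) (f' : N' → N') (h : ∀ x, e (f x) = f' (e x)) (hf : Function.Exact f f) :
    Function.Exact f' f' := by
  intro y
  obtain ⟨x, rfl⟩ := e.surjective y
  rw [← h, map_eq_zero_iff e e.injective, hf x]
  constructor
  · rintro ⟨z, rfl⟩
    exact ⟨e z, (h z).symm⟩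
  · rintro ⟨z, hz⟩
    obtain ⟨w, rfl⟩ := e.surjective z
    rw [← h] at hz
    exact ⟨w, e.injective hz⟩

/-- Unbundled introduction rule. -/
lemma IsSGFlat.mk' {R : Type u} [CommRing R] {M F : Type u} [AddCommGroup M] [Module R M]
    [AddCommGroup F] [Module R F] (hF : Module.Flat R F) (f : F →ₗ[R] F)
    (hf : Function.Exact f f) (e : M ≃ₗ[R] LinearMap.range f)
    (hI : ∀ (I : Type u) [AddCommGroup I] [Module R I], Module.Injective R I →
      Function.Exact (LinearMap.rTensor I f) (LinearMap.rTensor I f)) : IsSGFlat R M :=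
  ⟨ModuleCat.of R F, hF, f, hf.linearMap_comp_eq_zero, hf.linearMap_ker_eq, ⟨e⟩,
    fun I hi => (hI I hi).linearMap_ker_eq⟩

/-- Unbundled elimination rule. -/
lemma IsSGFlat.elim {R : Type u} [CommRing R] {M : Type u} [AddCommGroup M] [Module R M]
    (h : IsSGFlat R M) : ∃ (F : Type u) (_ : AddCommGroup F) (_ : Module R F)
      (_ : Module.Flat R F) (f : F →ₗ[R] F) (_ : Function.Exact f f)
      (_ : M ≃ₗ[R] LinearMap.range f),
      ∀ (I : Type u) [AddCommGroup I] [Module R I], Module.Injective R I →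
      Function.Exact (LinearMap.rTensor I f) (LinearMap.rTensor I f) := by
  obtain ⟨F, hF, f, h0, hk, ⟨e⟩, hI⟩ := h
  exact ⟨F, inferInstance, inferInstance, hF, f, LinearMap.exact_iff.2 hk, e,
    fun I _ _ hi => LinearMap.exact_iff.2 (hI (ModuleCat.of R I) hi)⟩

lemma IsSGFlat.congr {R : Type u} [CommRing R] {M N : Type u} [AddCommGroup M] [Module R M]
    [AddCommGroup N] [Module R N] (e : M ≃ₗ[R] N) (h : IsSGFlat R M) : IsSGFlat R N := by
  obtain ⟨F, _, _, hF, f, hf, e', hI⟩ := h.elim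
  exact .mk' hF f hf (e.symm.trans e') hI

lemma exact_prodMap {A B : Type*} [AddCommGroup A] [AddCommGroup B] (f : A → A) (g : B → B)
    (hf : Function.Exact f f) (hg : Function.Exact g g) :
    Function.Exact (Prod.map f g) (Prod.map f g) := by
  rintro ⟨a, b⟩
  simp only [Prod.map_apply, Prod.mk_eq_zero, hf a, hg b]
  constructor
  · rintro ⟨⟨x, rfl⟩, ⟨y, rfl⟩⟩
    exact ⟨(x, y), rfl⟩
  · rintro ⟨⟨x, y⟩, h⟩
    simp only [Prod.map_apply, Prod.mk.injEq] at h
    exact ⟨⟨x, h.1⟩, ⟨y, h.2⟩⟩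

lemma flat_prod {R : Type u} [CommRing R] (F G : Type u) [AddCommGroup F] [Module R F]
    [AddCommGroup G] [Module R G] [Module.Flat R F] [Module.Flat R G] : Module.Flat R (F × G) := by
  rw [Module.Flat.iff_rTensor_preserves_injective_linearMap]
  intro X Y _ _ _ _ f hf
  have h1 := Module.Flat.rTensor_preserves_injective_linearMap (M := F) f hf
  have h2 := Module.Flat.rTensor_preserves_injective_linearMap (M := G) f hf
  have hc : (TensorProduct.prodRight R R Y F G).toLinearMap ∘ₗ f.rTensor (F × G) =
      (f.rTensor F).prodMap (f.rTensor G) ∘ₗ (TensorProduct.prodRight R R X F G).toLinearMap := by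
    ext <;> simp
  have hi : Function.Injective ((TensorProduct.prodRight R R Y F G) ∘ f.rTensor (F × G)) := by
    have : ((TensorProduct.prodRight R R Y F G) ∘ f.rTensor (F × G)) =
        (Prod.map (f.rTensor F) (f.rTensor G)) ∘ (TensorProduct.prodRight R R X F G) :=
      funext fun x => LinearMap.congr_fun hc x
    rw [this]
    exact (h1.prodMap h2).comp (LinearEquiv.injective _)
  exact hi.of_comp

lemma IsSGFlat.prod {R : Type u} [CommRing R] {M N : Type u} [AddCommGroup M] [Module R M]
    [AddCommGroup N] [Module R N] (hM : IsSGFlat R M) (hN : IsSGFlat R N) :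
    IsSGFlat R (M × N) := by
  obtain ⟨F, _, _, hF, f, hf, e, hI⟩ := hM.elim
  obtain ⟨G, _, _, hG, g, hg, e', hJ⟩ := hN.elim
  have hr : Function.Injective
      ((LinearMap.range f).subtype.prodMap (LinearMap.range g).subtype) := by
    rw [LinearMap.coe_prodMap]
    exact Function.Injective.prodMap Subtype.val_injective Subtype.val_injective
  have hr2 : LinearMap.range ((LinearMap.range f).subtype.prodMap (LinearMap.range g).subtype)
      = LinearMap.range (f.prodMap g) := by
    rw [LinearMap.range_prodMap, LinearMap.range_prodMap, Submodule.range_subtype,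
      Submodule.range_subtype]
  refine .mk' (F := F × G) (flat_prod F G) (f.prodMap g) ?_ ((e.prodCongr e').trans
    ((LinearEquiv.ofInjective _ hr).trans (LinearEquiv.ofEq _ _ hr2))) ?_
  · rw [LinearMap.coe_prodMap]
    exact exact_prodMap _ _ hf hg
  · intro I _ _ hi
    refine exact_conj (TensorProduct.prodLeft R R F G I).symm.toAddEquiv _ _ ?_
      (exact_prodMap _ _ (hI I hi) (hJ I hi))
    intro x
    obtain ⟨y, rfl⟩ := (TensorProduct.prodLeft R R F G I).surjective x
    induction y with
    | zero => simp [Prod.map]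
    | add y z hy hz =>
      have key : ∀ a b : (F ⊗[R] I) × (G ⊗[R] I),
        Prod.map (rTensor I f) (rTensor I g) (a + b) =
          Prod.map (rTensor I f) (rTensor I g) a + Prod.map (rTensor I f) (rTensor I g) b := by
        intro a b; simp [Prod.map]
      rw [map_add, key, map_add, map_add, map_add, hy, hz]
    | tmul y z =>
      obtain ⟨a, b⟩ := y
      simp

section Alg

variable {R S : Type u} [CommRing R] [CommRing S] [Algebra R S]

lemma proj_of_sec
    (σ : S →ₗ[R] R) (hσ : ∀ s, algebraMap R S (σ s) = s)
    : Module.Projective R S :=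
  Module.Projective.of_split σ (Algebra.linearMap R S) (by ext s; simp [hσ])

lemma flat_of_sec
    (σ : S →ₗ[R] R) (hσ : ∀ s, algebraMap R S (σ s) = s)
    : Module.Flat R S :=
  have := proj_of_sec σ hσ
  inferInstance

lemma inj_restrict [Module.Flat R S] (I : Type u) [AddCommGroup I] [Module R I] [Module S I]
    [IsScalarTower R S I] (hI : Module.Injective S I) : Module.Injective R I := by
  constructor
  intro X Y _ _ _ _ f hf g
  obtain ⟨h, hh⟩ := hI.out (f.baseChange S) (Module.Flat.lTensor_preserves_injective_linearMap f hf)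
    (LinearMap.liftBaseChange S g)
  refine ⟨(h.restrictScalars R) ∘ₗ (TensorProduct.mk R S Y 1), fun x => ?_⟩
  have := hh (1 ⊗ₜ x)
  simpa using this

/-- `S`-linearity is automatic. -/
lemma map_smul_of_sec
    (σ : S →ₗ[R] R) (hσ : ∀ s, algebraMap R S (σ s) = s)
    {X Y : Type*} [AddCommGroup X] [AddCommGroup Y] [Module R X] [Module S X]
    [IsScalarTower R S X] [Module R Y] [Module S Y] [IsScalarTower R S Y] (g : X →ₗ[R] Y)
    (s : S) (x : X) : g (s • x) = s • g x := by
  rw [← hσ s, algebraMap_smul, algebraMap_smul, map_smul]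

/-- The retraction `S ⊗ I → I`. -/
noncomputable def retr (σ : S →ₗ[R] R) (I : Type u) [AddCommGroup I] [Module R I] :
    S ⊗[R] I →ₗ[R] I :=
  (TensorProduct.lid R I).toLinearMap ∘ₗ σ.rTensor I

lemma one_retr
    (σ : S →ₗ[R] R) (hσ : ∀ s, algebraMap R S (σ s) = s)
    (I : Type u) [AddCommGroup I] [Module R I] (x : S ⊗[R] I) :
    (1 : S) ⊗ₜ[R] (retr σ I x) = x := by
  induction x with
  | zero => simp
  | add a b ha hb => rw [map_add, TensorProduct.tmul_add, ha, hb]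
  | tmul s i =>
    simp only [retr, LinearMap.comp_apply, LinearMap.rTensor_tmul, LinearEquiv.coe_coe,
      TensorProduct.lid_tmul]
    rw [← TensorProduct.smul_tmul, Algebra.smul_def, hσ, mul_one]

lemma inj_baseChange
    (σ : S →ₗ[R] R) (hσ : ∀ s, algebraMap R S (σ s) = s)
    (I : Type u) [AddCommGroup I] [Module R I]
    (hI : Module.Injective R I) : Module.Injective S (S ⊗[R] I) := by
  constructor
  intro X Y _ _ _ _ f hf g
  let := Module.compHom X (algebraMap R S)
  let := Module.compHom Y (algebraMap R S)
  have : IsScalarTower R S X := IsScalarTower.of_algebraMap_smul fun r x => rfl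
  have : IsScalarTower R S Y := IsScalarTower.of_algebraMap_smul fun r x => rfl
  obtain ⟨h, hh⟩ := hI.out (f.restrictScalars R) hf (retr σ I ∘ₗ g.restrictScalars R)
  let k : Y →ₗ[R] S ⊗[R] I := TensorProduct.mk R S I 1 ∘ₗ h
  refine ⟨{ toFun := k, map_add' := map_add k, map_smul' := map_smul_of_sec σ hσ k },
    fun x => ?_⟩
  have := hh x
  simp only [LinearMap.coe_restrictScalars, LinearMap.comp_apply] at this
  simp [k, this, one_retr σ hσ]

lemma IsSGFlat.baseChange
    (σ : S →ₗ[R] R) (hσ : ∀ s, algebraMap R S (σ s) = s)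
    {M : Type u} [AddCommGroup M] [Module R M] (hM : IsSGFlat R M) :
    IsSGFlat S (S ⊗[R] M) := by
  have hflat := flat_of_sec σ hσ
  obtain ⟨F, _, _, hF, f, hf, e, hI⟩ := hM.elim
  have hinj : Function.Injective ((LinearMap.range f).subtype.baseChange S) :=
    Module.Flat.lTensor_preserves_injective_linearMap _ Subtype.val_injective
  have hrange : LinearMap.range ((LinearMap.range f).subtype.baseChange S) =
      LinearMap.range (f.baseChange S) := by
    have hs : Function.Surjective (f.rangeRestrict.baseChange S) :=
      LinearMap.lTensor_surjective S f.surjective_rangeRestrict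
    have hc : f.baseChange S = (LinearMap.range f).subtype.baseChange S ∘ₗ
        f.rangeRestrict.baseChange S := by
      rw [← LinearMap.baseChange_comp]; rfl
    rw [hc, LinearMap.range_comp_of_range_eq_top _ (LinearMap.range_eq_top.2 hs)]
  refine .mk' (F := S ⊗[R] F) inferInstance (f.baseChange S)
    (Module.Flat.lTensor_exact S hf)
    ((e.baseChange R S _ _).trans
      ((LinearEquiv.ofInjective _ hinj).trans (LinearEquiv.ofEq _ _ hrange))) ?_
  intro I _ _ hi
  let := Module.compHom I (algebraMap R S)
  have : IsScalarTower R S I := IsScalarTower.of_algebraMap_smul fun r x => rfl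
  have h2 := hI I (inj_restrict (S := S) I hi)
  let E : F ⊗[R] I ≃+ (S ⊗[R] F) ⊗[S] I :=
    ((TensorProduct.comm R F I).toAddEquiv.trans
      (TensorProduct.AlgebraTensorModule.cancelBaseChange R S S I F).symm.toAddEquiv).trans
      (TensorProduct.comm S I (S ⊗[R] F)).toAddEquiv
  refine exact_conj E _ _ ?_ h2
  intro x
  induction x with
  | zero => simp
  | add a b ha hb => simp only [map_add, ha, hb]
  | tmul a b => simp [E]

lemma IsSGFlat.restrict
    (σ : S →ₗ[R] R) (hσ : ∀ s, algebraMap R S (σ s) = s)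
    {N : Type u} [AddCommGroup N] [Module R N] [Module S N]
    [IsScalarTower R S N] (hN : IsSGFlat S N) : IsSGFlat R N := by
  have hflat := flat_of_sec σ hσ
  obtain ⟨F, _, _, hF, f, hf, e, hI⟩ := hN.elim
  let := Module.compHom F (algebraMap R S)
  have : IsScalarTower R S F := IsScalarTower.of_algebraMap_smul fun r x => rfl
  refine .mk' (F := F) (Module.Flat.trans R S F) (f.restrictScalars R) hf
    (e.restrictScalars R) ?_
  intro I _ _ hi
  have h2 := hI (S ⊗[R] I) (inj_baseChange σ hσ I hi)
  refine exact_conj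
    (TensorProduct.AlgebraTensorModule.cancelBaseChange R S S F I).toAddEquiv _ _ ?_ h2
  intro x
  obtain ⟨x, rfl⟩ :=
    (TensorProduct.AlgebraTensorModule.cancelBaseChange R S S F I).symm.surjective x
  induction x with
  | zero => simp
  | add a b ha hb => simp only [map_add, ha, hb]
  | tmul a b => simp

/-- `S ⊗ N ≃ N` for an `S`-module `N`. -/
lemma nonempty_equiv
    (σ : S →ₗ[R] R) (hσ : ∀ s, algebraMap R S (σ s) = s)
    (N : Type u) [AddCommGroup N] [Module R N] [Module S N]
    [IsScalarTower R S N] : Nonempty (S ⊗[R] N ≃ₗ[S] N) := by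
  refine ⟨LinearEquiv.ofBijective (LinearMap.liftBaseChange S (LinearMap.id : N →ₗ[R] N))
    ⟨?_, fun n => ⟨1 ⊗ₜ n, by simp⟩⟩⟩
  intro x y hxy
  rw [← one_retr σ hσ N x, ← one_retr σ hσ N y] at hxy ⊢
  simp only [LinearMap.liftBaseChange_tmul, one_smul, LinearMap.id_apply] at hxy
  rw [hxy]

lemma isSGFlat_iff_restrict
    (σ : S →ₗ[R] R) (hσ : ∀ s, algebraMap R S (σ s) = s)
    (N : Type u) [AddCommGroup N] [Module R N] [Module S N]
    [IsScalarTower R S N] : IsSGFlat R N ↔ IsSGFlat S N := by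
  obtain ⟨e⟩ := nonempty_equiv σ hσ N
  exact ⟨fun h => (h.baseChange σ hσ).congr e, fun h => h.restrict σ hσ⟩

lemma proj_restrict
    (σ : S →ₗ[R] R) (hσ : ∀ s, algebraMap R S (σ s) = s)
    (P : Type u) [AddCommGroup P] [Module R P] [Module S P]
    [IsScalarTower R S P] (hP : Module.Projective S P) : Module.Projective R P := by
  have := proj_of_sec σ hσ
  obtain ⟨s, hs⟩ := (Module.projective_def').1 hP
  have : Module.Projective R (P →₀ S) :=
    Module.Projective.of_split (M := P →₀ R) (Finsupp.mapRange.linearMap σ)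
      (Finsupp.mapRange.linearMap (Algebra.linearMap R S)) (by
        ext a b
        simp [hσ])
  exact Module.Projective.of_split (M := P →₀ S) (s.restrictScalars R)
    ((Finsupp.linearCombination S id).restrictScalars R)
    (by ext x; exact LinearMap.congr_fun hs x)

lemma resolving_descend
    (σ : S →ₗ[R] R) (hσ : ∀ s, algebraMap R S (σ s) = s)
    (h : ProjResolving R (fun M : ModuleCat.{u} R => IsSGFlat R M)) :
    ProjResolving S (fun M : ModuleCat.{u} S => IsSGFlat S M) := by
  obtain ⟨h1, h2⟩ := h
  constructor
  · intro P hP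
    let := Module.compHom P (algebraMap R S)
    have : IsScalarTower R S P := IsScalarTower.of_algebraMap_smul fun r x => rfl
    exact (isSGFlat_iff_restrict σ hσ P).1
      (h1 (ModuleCat.of R P) (proj_restrict σ hσ P hP))
  · intro A B C i p hi hp hip hC
    let := Module.compHom A (algebraMap R S)
    have : IsScalarTower R S A := IsScalarTower.of_algebraMap_smul fun r x => rfl
    let := Module.compHom B (algebraMap R S)
    have : IsScalarTower R S B := IsScalarTower.of_algebraMap_smul fun r x => rfl
    let := Module.compHom C (algebraMap R S)
    have : IsScalarTower R S C := IsScalarTower.of_algebraMap_smul fun r x => rfl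
    have hex : Function.Exact i p := LinearMap.exact_iff.2 hip.symm
    have := h2 (ModuleCat.of R A) (ModuleCat.of R B) (ModuleCat.of R C)
      (i.restrictScalars R) (p.restrictScalars R) hi hp
      (Function.Exact.linearMap_ker_eq (f := i.restrictScalars R) (g := p.restrictScalars R)
        hex).symm ((isSGFlat_iff_restrict σ hσ C).2 hC)
    exact (isSGFlat_iff_restrict σ hσ A).symm.trans
      (this.trans (isSGFlat_iff_restrict σ hσ B))

/-- The exactness condition after base change. -/
lemma resolving_baseChange
    (σ : S →ₗ[R] R) (hσ : ∀ s, algebraMap R S (σ s) = s)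
    (h : ProjResolving S (fun M : ModuleCat.{u} S => IsSGFlat S M))
    (A B C : ModuleCat.{u} R) (i : A →ₗ[R] B) (p : B →ₗ[R] C)
    (hi : Function.Injective i) (hp : Function.Surjective p)
    (hip : LinearMap.range i = LinearMap.ker p) (hC : IsSGFlat S (S ⊗[R] C)) :
    IsSGFlat S (S ⊗[R] A) ↔ IsSGFlat S (S ⊗[R] B) := by
  have hflat := flat_of_sec σ hσ
  have hex : Function.Exact i p := LinearMap.exact_iff.2 hip.symm
  exact h.2 (ModuleCat.of S (S ⊗[R] A)) (ModuleCat.of S (S ⊗[R] B)) (ModuleCat.of S (S ⊗[R] C))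
    (i.baseChange S) (p.baseChange S)
    (Module.Flat.lTensor_preserves_injective_linearMap i hi)
    (LinearMap.lTensor_surjective S hp)
    (Function.Exact.linearMap_ker_eq (f := i.baseChange S) (g := p.baseChange S)
      (Module.Flat.lTensor_exact S hex)).symm hC

end Alg

section Two

variable {R S T : Type u} [CommRing R] [CommRing S] [Algebra R S] [CommRing T] [Algebra R T]

lemma isSGFlat_iff_two
    (σ : S →ₗ[R] R) (hσ : ∀ s, algebraMap R S (σ s) = s)
    (τ : T →ₗ[R] R) (hτ : ∀ t, algebraMap R T (τ t) = t)
    (hsum : σ 1 + τ 1 = 1)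
    (M : Type u) [AddCommGroup M] [Module R M] :
    IsSGFlat R M ↔ IsSGFlat S (S ⊗[R] M) ∧ IsSGFlat T (T ⊗[R] M) := by
  constructor
  · intro h
    exact ⟨h.baseChange σ hσ, h.baseChange τ hτ⟩
  · rintro ⟨h1, h2⟩
    have h3 : IsSGFlat R ((S ⊗[R] M) × (T ⊗[R] M)) :=
      (h1.restrict σ hσ).prod (h2.restrict τ hτ)
    have hσ1 : algebraMap R S (σ 1) = 1 := hσ 1
    have hτ1 : algebraMap R T (τ 1) = 1 := hτ 1
    have hσ0 : algebraMap R S (τ 1) = 0 := by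
      have := congrArg (algebraMap R S) hsum
      rw [map_add, hσ1, map_one (algebraMap R S)] at this
      simpa using this
    have hτ0 : algebraMap R T (σ 1) = 0 := by
      have := congrArg (algebraMap R T) hsum
      rw [map_add, add_comm, hτ1, map_one (algebraMap R T)] at this
      simpa using this
    let g : M →ₗ[R] (S ⊗[R] M) × (T ⊗[R] M) :=
      (TensorProduct.mk R S M 1).prod (TensorProduct.mk R T M 1)
    have hk1 : ∀ m, retr σ M (1 ⊗ₜ m) = σ 1 • m := fun m => by simp [retr]
    have hk2 : ∀ m, retr τ M (1 ⊗ₜ m) = τ 1 • m := fun m => by simp [retr]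
    have hg : Function.Bijective g := by
      constructor
      · rw [← LinearMap.ker_eq_bot, LinearMap.ker_eq_bot']
        intro m hm
        have hm1 : (1 : S) ⊗ₜ[R] m = 0 := congrArg Prod.fst hm
        have hm2 : (1 : T) ⊗ₜ[R] m = 0 := congrArg Prod.snd hm
        rw [← one_smul R m, ← hsum, add_smul, ← hk1, ← hk2, hm1, hm2]
        simp
      · rintro ⟨a, b⟩
        refine ⟨σ 1 • retr σ M a + τ 1 • retr τ M b, ?_⟩
        refine Prod.ext ?_ ?_
        · change (1 : S) ⊗ₜ[R] (σ 1 • retr σ M a + τ 1 • retr τ M b) = a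
          rw [TensorProduct.tmul_add, ← TensorProduct.smul_tmul, ← TensorProduct.smul_tmul,
            Algebra.smul_def, Algebra.smul_def, hσ1, hσ0]
          simp [one_retr σ hσ]
        · change (1 : T) ⊗ₜ[R] (σ 1 • retr σ M a + τ 1 • retr τ M b) = b
          rw [TensorProduct.tmul_add, ← TensorProduct.smul_tmul, ← TensorProduct.smul_tmul,
            Algebra.smul_def, Algebra.smul_def, hτ1, hτ0]
          simp [one_retr τ hτ]
    exact h3.congr (LinearEquiv.ofBijective g hg).symm

lemma resolving_two
    (σ : S →ₗ[R] R) (hσ : ∀ s, algebraMap R S (σ s) = s)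
    (τ : T →ₗ[R] R) (hτ : ∀ t, algebraMap R T (τ t) = t)
    (hsum : σ 1 + τ 1 = 1)
    :
    ProjResolving R (fun M : ModuleCat.{u} R => IsSGFlat R M) ↔
      (ProjResolving S (fun M : ModuleCat.{u} S => IsSGFlat S M) ∧
       ProjResolving T (fun M : ModuleCat.{u} T => IsSGFlat T M)) := by
  refine ⟨fun h => ⟨resolving_descend σ hσ h, resolving_descend τ hτ h⟩, ?_⟩
  rintro ⟨hS, hT⟩
  have key := fun M : ModuleCat.{u} R => isSGFlat_iff_two σ hσ τ hτ hsum M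
  constructor
  · intro P hP
    exact (key P).2 ⟨hS.1 (ModuleCat.of S (S ⊗[R] P)) inferInstance,
      hT.1 (ModuleCat.of T (T ⊗[R] P)) inferInstance⟩
  · intro A B C i p hi hp hip hC
    have hC' := (key C).1 hC
    have h1 := resolving_baseChange σ hσ hS A B C i p hi hp hip hC'.1
    have h2 := resolving_baseChange τ hτ hT A B C i p hi hp hip hC'.2
    exact (key A).trans ((and_congr h1 h2).trans (key B).symm)

end Two

end Helpers

/-- For coherent rings `R₁`, `R₂` of finite Gorenstein weak dimension, the
class of strongly Gorenstein flat `R₁ × R₂`-modules is projectively resolving iff the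
classes of strongly Gorenstein flat `Rᵢ`-modules are projectively resolving for `i = 1, 2`. -/
theorem stmt19 (R₁ R₂ : Type u) [CommRing R₁] [CommRing R₂]
    (hc₁ : IsCoherent R₁) (hc₂ : IsCoherent R₂)
    (hw₁ : ∃ n : ℕ, ∀ M : ModuleCat.{u} R₁, GfdLE R₁ n M)
    (hw₂ : ∃ n : ℕ, ∀ M : ModuleCat.{u} R₂, GfdLE R₂ n M) :
    ProjResolving (R₁ × R₂) (fun M : ModuleCat.{u} (R₁ × R₂) => IsSGFlat (R₁ × R₂) M) ↔
      (ProjResolving R₁ (fun M : ModuleCat.{u} R₁ => IsSGFlat R₁ M) ∧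
       ProjResolving R₂ (fun M : ModuleCat.{u} R₂ => IsSGFlat R₂ M)) := by
  let : Algebra (R₁ × R₂) R₁ := (RingHom.fst R₁ R₂).toAlgebra
  let : Algebra (R₁ × R₂) R₂ := (RingHom.snd R₁ R₂).toAlgebra
  let σ : R₁ →ₗ[R₁ × R₂] (R₁ × R₂) :=
    { toFun := fun x => (x, 0)
      map_add' := fun x y => by simp
      map_smul' := fun r x => Prod.ext rfl (mul_zero r.2).symm }
  let τ : R₂ →ₗ[R₁ × R₂] (R₁ × R₂) :=
    { toFun := fun x => (0, x)
      map_add' := fun x y => by simp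
      map_smul' := fun r x => Prod.ext (mul_zero r.1).symm rfl }
  exact resolving_two σ (fun _ => rfl) τ (fun _ => rfl)
    (Prod.ext (add_zero (1 : R₁)) (zero_add (1 : R₂)))
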